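/- Let p be an odd prime and G a powerful p-group (i.e., a finite p-group with [G,G] ≤ G^p). If N is a normal subgroup of G with N ≤ G^p, then N is powerfully nilpotent, i.e., N admits an ascending chain of subgroups 1 = H_0 ≤ H_1 ≤ ... ≤ H_n = N with [H_i, N] ≤ H_{i-1}^p for all i = 1, ..., n. -/

import Mathlib

/-- For a subgroup `H` of `G`, the subgroup generated by `n`-th powers of elements of `H`. -/
def sgPow {G : Type*} [Group G] (H : Subgroup G) (n : ℕ) : Subgroup G :=
  Subgroup.closure {x | ∃ h ∈ H, h ^ n = x}

/-- `N` is powerfully nilpotent (w.r.t. the prime `p`): there is an ascending chain of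
subgroups `⊥ = H 0 ≤ H 1 ≤ ⋯ ≤ H n = N` with `[H (i+1), N] ≤ (H i)^p`. -/
def PowerfullyNilpotentOn {G : Type*} [Group G] (p : ℕ) (N : Subgroup G) : Prop :=
  ∃ (n : ℕ) (H : ℕ → Subgroup G), H 0 = ⊥ ∧ H n = N ∧ (∀ i, H i ≤ H (i + 1)) ∧
    (∀ i, H i ≤ N) ∧ ∀ i < n, ⁅H (i + 1), N⁆ ≤ sgPow (H i) p

open Subgroup

open scoped commutatorElement

section Elementwise

variable {G : Type*} [Group G]

theorem mul_pow_of_class_two {a b z : G} (h : b * a = a * b * z) (hza : Commute z a)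
    (hzb : Commute z b) (n : ℕ) : (a * b) ^ n = a ^ n * b ^ n * z ^ n.choose 2 := by
  have key : ∀ m : ℕ, b ^ m * a = a * b ^ m * z ^ m := by
    intro m
    induction m with
    | zero => simp
    | succ m ih =>
      calc b ^ (m + 1) * a = b ^ m * (b * a) := by rw [pow_succ, mul_assoc]
        _ = (b ^ m * a) * b * z := by rw [h]; group
        _ = a * b ^ m * (z ^ m * b) * z := by rw [ih]; group
        _ = a * b ^ m * (b * z ^ m) * z := by rw [(hzb.pow_left m).eq]
        _ = a * b ^ (m + 1) * z ^ (m + 1) := by rw [pow_succ, pow_succ]; group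
  induction n with
  | zero => simp
  | succ n ih =>
    have hc : (n + 1).choose 2 = n + n.choose 2 := by
      rw [Nat.choose_succ_succ' n 1, Nat.choose_one_right]
    calc (a * b) ^ (n + 1) = a ^ n * b ^ n * (z ^ n.choose 2 * (a * b)) := by
          rw [pow_succ, ih, mul_assoc]
      _ = a ^ n * (b ^ n * a) * b * z ^ n.choose 2 := by
          rw [((hza.mul_right hzb).pow_left _).eq]; group
      _ = a ^ n * a * b ^ n * (z ^ n * b) * z ^ n.choose 2 := by rw [key]; group
      _ = a ^ n * a * b ^ n * (b * z ^ n) * z ^ n.choose 2 := by rw [(hzb.pow_left n).eq]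
      _ = a ^ (n + 1) * b ^ (n + 1) * z ^ (n + 1).choose 2 := by
          rw [hc, pow_add z, pow_succ, pow_succ]; simp only [mul_assoc]

theorem Nat.Prime.dvd_choose_two {p : ℕ} (hp : p.Prime) (hodd : Odd p) : p ∣ p.choose 2 :=
  hp.dvd_choose_self two_ne_zero (hp.two_le.lt_of_ne (by rintro rfl; exact absurd hodd (by decide)))

theorem pow_choose_two_eq_one {p : ℕ} (hp : p.Prime) (hodd : Odd p) {z : G} (hz : z ^ p = 1) :
    z ^ p.choose 2 = 1 := by
  obtain ⟨k, hk⟩ := hp.dvd_choose_two hodd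
  rw [hk, pow_mul, hz, one_pow]

theorem mul_pow_prime {p : ℕ} (hp : p.Prime) (hodd : Odd p) {a b : G}
    (ha : Commute ⁅b⁻¹, a⁻¹⁆ a) (hb : Commute ⁅b⁻¹, a⁻¹⁆ b) (hz : ⁅b⁻¹, a⁻¹⁆ ^ p = 1) :
    (a * b) ^ p = a ^ p * b ^ p := by
  rw [mul_pow_of_class_two (z := ⁅b⁻¹, a⁻¹⁆) (by rw [commutatorElement_def]; group) ha hb,
    pow_choose_two_eq_one hp hodd hz, mul_one]

theorem conj_pow_of_class_three {g x d e : G} (hx : g * x * g⁻¹ = d * x)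
    (hd : g * d * g⁻¹ = e * d) (he : Commute g e) (hde : Commute d e) (n : ℕ) :
    g ^ n * x * (g ^ n)⁻¹ = e ^ n.choose 2 * d ^ n * x := by
  induction n with
  | zero => simp
  | succ n ih =>
    have hc : (n + 1).choose 2 = n.choose 2 + n := by
      rw [Nat.choose_succ_succ' n 1, Nat.choose_one_right, add_comm]
    have h1 : g * e ^ n.choose 2 * g⁻¹ = e ^ n.choose 2 := by
      rw [(he.pow_right _).eq, mul_inv_cancel_right]
    have h2 : g * d ^ n * g⁻¹ = e ^ n * d ^ n := by
      rw [← conj_pow, hd, hde.symm.mul_pow]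
    calc g ^ (n + 1) * x * (g ^ (n + 1))⁻¹ = g * (g ^ n * x * (g ^ n)⁻¹) * g⁻¹ := by
          rw [pow_succ']; group
      _ = (g * e ^ n.choose 2 * g⁻¹) * (g * d ^ n * g⁻¹) * (g * x * g⁻¹) := by rw [ih]; group
      _ = e ^ (n + 1).choose 2 * d ^ (n + 1) * x := by
          rw [h1, h2, hx, hc, pow_add, pow_succ]; simp only [mul_assoc]

end Elementwise

section SgPow

variable {G G' : Type*} [Group G] [Group G']

theorem pow_mem_sgPow {H : Subgroup G} {n : ℕ} {x : G} (hx : x ∈ H) : x ^ n ∈ sgPow H n :=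
  subset_closure ⟨x, hx, rfl⟩

theorem sgPow_le_iff {H K : Subgroup G} {n : ℕ} : sgPow H n ≤ K ↔ ∀ x ∈ H, x ^ n ∈ K := by
  refine ⟨fun h x hx => h (pow_mem_sgPow hx), fun h => (closure_le K).2 ?_⟩
  rintro _ ⟨x, hx, rfl⟩
  exact h x hx

theorem sgPow_le (H : Subgroup G) (n : ℕ) : sgPow H n ≤ H :=
  sgPow_le_iff.2 fun _ hx => pow_mem hx n

theorem sgPow_mono {H K : Subgroup G} (h : H ≤ K) (n : ℕ) : sgPow H n ≤ sgPow K n :=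
  sgPow_le_iff.2 fun _ hx => pow_mem_sgPow (h hx)

theorem map_sgPow (f : G →* G') (H : Subgroup G) (n : ℕ) :
    (sgPow H n).map f = sgPow (H.map f) n := by
  apply le_antisymm
  · rw [map_le_iff_le_comap, sgPow_le_iff]
    intro x hx
    rw [mem_comap, map_pow]
    exact pow_mem_sgPow (mem_map_of_mem f hx)
  · rw [sgPow_le_iff]
    rintro _ ⟨x, hx, rfl⟩
    rw [← map_pow]
    exact mem_map_of_mem f (pow_mem_sgPow hx)

instance sgPow_normal (H : Subgroup G) [hH : H.Normal] (n : ℕ) : (sgPow H n).Normal := by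
  constructor
  intro x hx g
  have h : (sgPow H n).map (MulAut.conj g).toMonoidHom ≤ sgPow H n := by
    rw [map_sgPow]
    refine sgPow_mono ?_ n
    rintro _ ⟨y, hy, rfl⟩
    exact hH.conj_mem y hy g
  exact h (mem_map_of_mem _ hx)

theorem sgPow_lt [Finite G] {p : ℕ} (hp : p.Prime) (hG : IsPGroup p G) {H : Subgroup G}
    (hH : H ≠ ⊥) : sgPow H p < H := by
  have := Fact.mk hp
  refine lt_of_le_of_ne (sgPow_le H p) fun heq => ?_
  have hHp : IsPGroup p H := hG.to_subgroup H
  obtain ⟨n, hn⟩ := IsPGroup.iff_card.1 hHp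
  have hn0 : n ≠ 0 := by
    rintro rfl
    exact hH ((Subgroup.card_eq_one).1 (by simpa using hn))
  obtain ⟨m, rfl⟩ := Nat.exists_eq_succ_of_ne_zero hn0
  obtain ⟨K, hK⟩ := Sylow.exists_subgroup_card_pow_prime (G := H) p (n := m)
    (hn ▸ pow_dvd_pow p (Nat.le_succ m))
  have hidx : K.index = p := by
    have h := K.card_mul_index
    rw [hK, hn, pow_succ] at h
    exact Nat.eq_of_mul_eq_mul_left (pow_pos hp.pos m) h
  have hKn : K.Normal := normal_of_index_eq_minFac_card (by
    rw [hidx, hn, hp.pow_minFac (Nat.succ_ne_zero m)])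
  have hle : H ≤ K.map H.subtype := by
    conv_lhs => rw [← heq]
    rw [sgPow_le_iff]
    intro x hx
    refine ⟨⟨x, hx⟩ ^ p, ?_, rfl⟩
    have h := K.pow_index_mem (⟨x, hx⟩ : H)
    rwa [hidx] at h
  have htop : K = ⊤ := by
    rw [eq_top_iff]
    rintro ⟨x, hx⟩ -
    obtain ⟨y, hy, hyx⟩ := hle hx
    have : y = ⟨x, hx⟩ := Subtype.ext hyx
    exact this ▸ hy
  rw [htop, index_top] at hidx
  exact hp.one_lt.ne hidx

theorem le_of_le_sup_commutator [Group.IsNilpotent G] {X Y : Subgroup G} [Y.Normal]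
    (h : X ≤ Y ⊔ ⁅X, (⊤ : Subgroup G)⁆) : X ≤ Y := by
  have key : ∀ n, X ≤ Y ⊔ (⊤ : Subgroup G).lowerCentralSeries n := by
    intro n
    induction n with
    | zero => simp
    | succ n ih =>
      refine h.trans (sup_le le_sup_left ?_)
      rw [commutator_le]
      intro x hx g _
      obtain ⟨y, hy, l, hl, rfl⟩ := mem_sup_of_normal_left.1 (ih hx)
      rw [commutatorElement_mul_left_eq_conj_mul]
      refine mul_mem ?_ (mem_sup_left ?_)
      · exact mem_sup_right (Normal.conj_mem inferInstance _
          (commutator_mem_commutator hl (mem_top g)) y)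
      · exact commutator_le_left Y ⊤ (commutator_mem_commutator hy (mem_top g))
  obtain ⟨n, hn⟩ := Subgroup.nilpotent_iff_lowerCentralSeries.1 ‹Group.IsNilpotent G›
  simpa [hn] using key n

end SgPow

section Powerful

variable {G : Type*} [Group G]

/-- The iterated power series `G ≥ G^p ≥ (G^p)^p ≥ ⋯`. -/
def powSeries (G : Type*) [Group G] (p : ℕ) : ℕ → Subgroup G
  | 0 => ⊤
  | i + 1 => sgPow (powSeries G p i) p

instance powSeries_normal (p i : ℕ) : (powSeries G p i).Normal := by
  induction i with
  | zero => exact inferInstanceAs (⊤ : Subgroup G).Normal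
  | succ i ih => exact sgPow_normal _ p

theorem powSeries_antitone (p : ℕ) : Antitone (powSeries G p) :=
  antitone_nat_of_succ_le fun i => sgPow_le (powSeries G p i) p

theorem map_powSeries {G' : Type*} [Group G'] {f : G →* G'} (hf : Function.Surjective f)
    (p i : ℕ) : (powSeries G p i).map f = powSeries G' p i := by
  induction i with
  | zero => exact map_top_of_surjective f hf
  | succ i ih => exact (map_sgPow f _ p).trans (congrArg (sgPow · p) ih)

theorem exists_powSeries_eq_bot [Finite G] {p : ℕ} (hp : p.Prime) (hG : IsPGroup p G) :
    ∃ n, powSeries G p n = ⊥ := by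
  by_contra! h
  exact not_strictAnti_of_wellFoundedLT (powSeries G p)
    (strictAnti_nat_of_succ_lt fun i => sgPow_lt hp hG (h i))

theorem pow_mem_powSeries_add {p i : ℕ} {x : G} (hx : x ∈ powSeries G p i) (k : ℕ) :
    x ^ p ^ k ∈ powSeries G p (i + k) := by
  induction k with
  | zero => simpa using hx
  | succ k ih =>
    rw [pow_succ, pow_mul]
    exact pow_mem_sgPow ih

theorem powerful_quotient {p : ℕ} (h : ⁅(⊤ : Subgroup G), (⊤ : Subgroup G)⁆ ≤ sgPow ⊤ p)
    (K : Subgroup G) [K.Normal] :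
    ⁅(⊤ : Subgroup (G ⧸ K)), (⊤ : Subgroup (G ⧸ K))⁆ ≤ sgPow ⊤ p := by
  have := map_mono (f := QuotientGroup.mk' K) h
  rwa [map_commutator, map_sgPow,
    map_top_of_surjective _ (QuotientGroup.mk'_surjective K)] at this

theorem commute_of_mem_sgPow {p : ℕ} (hp : p.Prime) (hodd : Odd p) {N : Subgroup G} [N.Normal]
    (hN : ∀ n ∈ N, ∀ g : G, ⁅g, n⁆ ∈ sgPow N p) (hpow : ∀ x ∈ sgPow N p, x ^ p = 1)
    (hcomm : ∀ x ∈ sgPow N p, ∀ g h : G, Commute ⁅g, x⁆ h) :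
    ∀ x ∈ sgPow N p, ∀ g : G, Commute g x := by
  have key : sgPow N p ≤ center G := by
    rw [sgPow_le_iff]
    intro n hn
    rw [mem_center_iff]
    intro g
    have ha := hN n hn g
    have hz := hcomm _ (inv_mem ha) n⁻¹
    have hzmem : ⁅n⁻¹, ⁅g, n⁆⁻¹⁆ ∈ sgPow N p :=
      commutator_le_right ⊤ _ (commutator_mem_commutator (mem_top _) (inv_mem ha))
    have h : (⁅g, n⁆ * n) ^ p = n ^ p := by
      rw [mul_pow_prime hp hodd (hz _) (hz _) (hpow _ hzmem), hpow _ ha, one_mul]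
    rw [← conj_eq_commutatorElement_mul, ← map_pow] at h
    exact mul_inv_eq_iff_eq_mul.1 h
  exact fun x hx g => mem_center_iff.1 (key hx) g

theorem commutator_sgPow_le [Group.IsNilpotent G] {p : ℕ} (hp : p.Prime) (hodd : Odd p)
    {N : Subgroup G} [N.Normal] (hN : ⁅N, (⊤ : Subgroup G)⁆ ≤ sgPow N p) :
    ⁅sgPow N p, (⊤ : Subgroup G)⁆ ≤ sgPow (sgPow N p) p := by
  refine le_of_le_sup_commutator ?_
  set W := sgPow (sgPow N p) p ⊔ ⁅⁅sgPow N p, (⊤ : Subgroup G)⁆, (⊤ : Subgroup G)⁆ with hW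
  let f := QuotientGroup.mk' W
  have hf : Function.Surjective f := QuotientGroup.mk'_surjective W
  have hfW : ∀ x, f x = 1 ↔ x ∈ W := fun x => QuotientGroup.eq_one_iff x
  have hn : (N.map f).Normal := Normal.map inferInstance f hf
  have key := commute_of_mem_sgPow (N := N.map f) hp hodd ?_ ?_ ?_
  · rw [commutator_le]
    intro x hx g _
    rw [← hfW, map_commutatorElement, commutatorElement_eq_one_iff_commute]
    exact (key _ (map_sgPow f N p ▸ mem_map_of_mem f hx) (f g)).symm
  · rintro _ ⟨n, hn, rfl⟩ g
    obtain ⟨g, rfl⟩ := hf g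
    rw [← map_commutatorElement, ← map_sgPow]
    refine mem_map_of_mem f (hN ?_)
    rw [commutator_comm]
    exact commutator_mem_commutator (mem_top g) hn
  · rw [← map_sgPow]
    rintro _ ⟨x, hx, rfl⟩
    rw [← map_pow, hfW]
    exact mem_sup_left (pow_mem_sgPow hx)
  · rw [← map_sgPow]
    rintro _ ⟨x, hx, rfl⟩ g h
    obtain ⟨g, rfl⟩ := hf g
    obtain ⟨h, rfl⟩ := hf h
    rw [← commutatorElement_eq_one_iff_commute, ← map_commutatorElement, ← map_commutatorElement,
      hfW]
    refine mem_sup_right (commutator_mem_commutator ?_ (mem_top h))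
    rw [commutator_comm]
    exact commutator_mem_commutator (mem_top g) hx

theorem commutator_powSeries_le [Group.IsNilpotent G] {p : ℕ} (hp : p.Prime) (hodd : Odd p)
    (h : ⁅(⊤ : Subgroup G), (⊤ : Subgroup G)⁆ ≤ sgPow ⊤ p) (i : ℕ) :
    ⁅powSeries G p i, (⊤ : Subgroup G)⁆ ≤ powSeries G p (i + 1) := by
  induction i with
  | zero => exact h
  | succ i ih => exact commutator_sgPow_le hp hodd ih

theorem commutatorElement_mem_powSeries [Group.IsNilpotent G] {p : ℕ} (hp : p.Prime)
    (hodd : Odd p) (h : ⁅(⊤ : Subgroup G), (⊤ : Subgroup G)⁆ ≤ sgPow ⊤ p) {i : ℕ} {x : G}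
    (hx : x ∈ powSeries G p i) (g : G) : ⁅g, x⁆ ∈ powSeries G p (i + 1) := by
  refine commutator_powSeries_le hp hodd h i ?_
  rw [commutator_comm]
  exact commutator_mem_commutator (mem_top g) hx

/-- Modulo `powSeries G p (s + 2)`, the `p`-th power of a product with one factor in
`powSeries G p s` is the product of the `p`-th powers. -/
theorem mul_pow_eq_mod_powSeries [Group.IsNilpotent G] {p : ℕ} (hp : p.Prime)
    (hodd : Odd p) (h : ⁅(⊤ : Subgroup G), (⊤ : Subgroup G)⁆ ≤ sgPow ⊤ p) {s : ℕ} (x : G) {y : G}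
    (hy : y ∈ powSeries G p s) :
    ((x * y) ^ p)⁻¹ * (x ^ p * y ^ p) ∈ powSeries G p (s + 2) := by
  let f := QuotientGroup.mk' (powSeries G p (s + 2))
  have hfW : ∀ x, f x = 1 ↔ x ∈ powSeries G p (s + 2) := fun x => QuotientGroup.eq_one_iff x
  have hz : ⁅y⁻¹, x⁻¹⁆ ∈ powSeries G p (s + 1) := by
    rw [← commutatorElement_inv]
    exact inv_mem (commutatorElement_mem_powSeries hp hodd h (inv_mem hy) _)
  have hc : ∀ g, Commute ⁅(f y)⁻¹, (f x)⁻¹⁆ (f g) := by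
    intro g
    rw [Commute.symm_iff, ← commutatorElement_eq_one_iff_commute]
    simp only [← map_inv, ← map_commutatorElement]
    rw [hfW]
    exact commutatorElement_mem_powSeries hp hodd h hz g
  rw [← hfW]
  simp only [map_mul, map_inv, map_pow]
  rw [mul_pow_prime hp hodd (hc _) (hc _), inv_mul_cancel]
  simp only [← map_inv, ← map_commutatorElement, ← map_pow]
  rw [hfW]
  exact pow_mem_sgPow hz

theorem exists_pow_mul_eq [Group.IsNilpotent G] {p : ℕ} (hp : p.Prime)
    (hodd : Odd p) (h : ⁅(⊤ : Subgroup G), (⊤ : Subgroup G)⁆ ≤ sgPow ⊤ p) {i s : ℕ} (his : i ≤ s)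
    {z : G} (hz : z ∈ powSeries G p (s + 1)) :
    ∀ x ∈ powSeries G p i, ∃ y ∈ powSeries G p i, ∃ w ∈ powSeries G p (s + 2),
      x ^ p * z = y ^ p * w := by
  have step : ∀ u ∈ powSeries G p s, ∀ v : G,
      (∀ x ∈ powSeries G p i, ∃ y ∈ powSeries G p i, ∃ w ∈ powSeries G p (s + 2),
        x ^ p * v = y ^ p * w) →
      ∀ x ∈ powSeries G p i, ∃ y ∈ powSeries G p i, ∃ w ∈ powSeries G p (s + 2),
        x ^ p * (u ^ p * v) = y ^ p * w := by
    intro u hu v hv x hx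
    obtain ⟨y, hy, w, hw, hyw⟩ := hv (x * u) (mul_mem hx (powSeries_antitone p his hu))
    have hr := mul_pow_eq_mod_powSeries hp hodd h x hu
    set r := ((x * u) ^ p)⁻¹ * (x ^ p * u ^ p) with hrdef
    refine ⟨y, hy, w * (v⁻¹ * r * v), mul_mem hw ?_, ?_⟩
    · simpa using (powSeries_normal (G := G) p (s + 2)).conj_mem r hr v⁻¹
    · rw [← mul_assoc (y ^ p), ← hyw, hrdef]
      group
  induction hz using closure_induction_left with
  | one => exact fun x hx => ⟨x, hx, 1, one_mem _, rfl⟩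
  | mul_left u hu v hv ih =>
    obtain ⟨u, hu, rfl⟩ := hu
    exact step u hu v ih
  | inv_mul_cancel u hu v hv ih =>
    obtain ⟨u, hu, rfl⟩ := hu
    rw [← inv_pow]
    exact step u⁻¹ (inv_mem hu) v ih

theorem exists_pow_eq_of_mem_powSeries [Finite G] {p : ℕ} (hp : p.Prime) (hodd : Odd p)
    (hG : IsPGroup p G) (h : ⁅(⊤ : Subgroup G), (⊤ : Subgroup G)⁆ ≤ sgPow ⊤ p) {i : ℕ} {z : G}
    (hz : z ∈ powSeries G p (i + 1)) : ∃ y ∈ powSeries G p i, y ^ p = z := by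
  have := Fact.mk hp
  have := hG.isNilpotent
  obtain ⟨n, hn⟩ := exists_powSeries_eq_bot hp hG
  have key : ∀ k, ∃ y ∈ powSeries G p i, ∃ w ∈ powSeries G p (i + k + 1), z = y ^ p * w := by
    intro k
    induction k with
    | zero => exact ⟨1, one_mem _, z, hz, by simp⟩
    | succ k ih =>
      obtain ⟨x, hx, w, hw, rfl⟩ := ih
      exact exists_pow_mul_eq hp hodd h (Nat.le_add_right i k) hw x hx
  obtain ⟨y, hy, w, hw, rfl⟩ := key n
  have hw1 : w ∈ powSeries G p n := powSeries_antitone p (by omega) hw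
  rw [hn, mem_bot] at hw1
  exact ⟨y, hy, by rw [hw1, mul_one]⟩

end Powerful

section Omega

variable {G : Type*} [Group G]

/-- Elements of `powSeries G p j` of order dividing `p` commute with the elements of order
dividing `p ^ j`, for all `j ≥ 1`. -/
def TorsionCommutes (G : Type*) [Group G] (p : ℕ) : Prop :=
  ∀ j, ∀ u ∈ powSeries G p (j + 1), ∀ g : G, u ^ p = 1 → g ^ p ^ (j + 1) = 1 → Commute u g

theorem zpowers_eq_top_of_sup_eq_top [Finite G] {p : ℕ} (hp : p.Prime) (hodd : Odd p)
    (hG : IsPGroup p G) (h : ⁅(⊤ : Subgroup G), (⊤ : Subgroup G)⁆ ≤ sgPow ⊤ p) {a : G}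
    (ha : zpowers a ⊔ powSeries G p 1 = ⊤) : zpowers a = ⊤ := by
  have := Fact.mk hp
  have := hG.isNilpotent
  obtain ⟨n, hn⟩ := exists_powSeries_eq_bot hp hG
  have key : ∀ k, zpowers a ⊔ powSeries G p (k + 1) = ⊤ := by
    intro k
    induction k with
    | zero => exact ha
    | succ k ih =>
      rw [eq_top_iff, ← ih]
      refine sup_le le_sup_left ?_
      refine (sgPow_le_iff (H := powSeries G p k)).2 fun w _ => ?_
      obtain ⟨b, hb, y, hy, rfl⟩ :=
        mem_sup_of_normal_right.1 (ih ▸ mem_top w : w ∈ zpowers a ⊔ powSeries G p (k + 1))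
      have hr := mul_pow_eq_mod_powSeries hp hodd h b hy
      have hr' := powSeries_antitone p (Nat.le_succ (k + 2)) hr
      have e : (b * y) ^ p = b ^ p * (y ^ p * (((b * y) ^ p)⁻¹ * (b ^ p * y ^ p))⁻¹) := by group
      rw [e]
      exact mul_mem_sup (pow_mem hb p) (mul_mem (pow_mem_sgPow hy) (inv_mem hr'))
  have hbot : powSeries G p (n + 1) = ⊥ :=
    le_bot_iff.1 (hn ▸ powSeries_antitone p (Nat.le_succ n))
  simpa [hbot] using key n

theorem powerful_zpowers_sup [Finite G] {p : ℕ} (hp : p.Prime) (hodd : Odd p)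
    (hG : IsPGroup p G) (h : ⁅(⊤ : Subgroup G), (⊤ : Subgroup G)⁆ ≤ sgPow ⊤ p) (a : G) :
    ⁅(⊤ : Subgroup ↥(zpowers a ⊔ powSeries G p 1)),
      (⊤ : Subgroup ↥(zpowers a ⊔ powSeries G p 1))⁆ ≤ sgPow ⊤ p := by
  have := Fact.mk hp
  have := hG.isNilpotent
  set H := zpowers a ⊔ powSeries G p 1 with hH
  rw [← map_le_map_iff_of_injective H.subtype_injective, map_commutator, map_sgPow, ← MonoidHom.range_eq_map,
    range_subtype]
  refine le_trans ?_ (sgPow_mono (le_sup_right : powSeries G p 1 ≤ H) p)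
  change ⁅H, H⁆ ≤ powSeries G p 2
  let f := QuotientGroup.mk' (powSeries G p 2)
  have hfW : ∀ x, f x = 1 ↔ x ∈ powSeries G p 2 := fun x => QuotientGroup.eq_one_iff x
  have hcen : ∀ x ∈ powSeries G p 1, ∀ g, Commute (f g) (f x) := by
    intro x hx g
    rw [← commutatorElement_eq_one_iff_commute, ← map_commutatorElement, hfW]
    exact commutatorElement_mem_powSeries hp hodd h hx g
  rw [commutator_le]
  intro x hx y hy
  obtain ⟨b, hb, u, hu, rfl⟩ := mem_sup_of_normal_right.1 hx
  obtain ⟨c, hc, v, hv, rfl⟩ := mem_sup_of_normal_right.1 hy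
  obtain ⟨m, rfl⟩ := mem_zpowers_iff.1 hb
  obtain ⟨n, rfl⟩ := mem_zpowers_iff.1 hc
  rw [← hfW, map_commutatorElement, commutatorElement_eq_one_iff_commute, map_mul f (a ^ n)]
  refine Commute.mul_right ?_ (hcen v hv _)
  rw [map_mul]
  refine Commute.mul_left ?_ (hcen u hu _).symm
  rw [map_zpow, map_zpow]
  exact Commute.zpow_zpow_self _ _ _

theorem torsionCommutes_of_quotients [Finite G] {p : ℕ} (hp : p.Prime) (hodd : Odd p)
    (hG : IsPGroup p G) (h : ⁅(⊤ : Subgroup G), (⊤ : Subgroup G)⁆ ≤ sgPow ⊤ p)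
    (hΩ : ∀ g : G, ∀ a ∈ zpowers g ⊔ powSeries G p 1, ∀ b ∈ zpowers g ⊔ powSeries G p 1,
      a ^ p = 1 → b ^ p = 1 → (a * b) ^ p = 1)
    (hquot : ∀ (K : Subgroup G) [K.Normal], K ≠ ⊥ → TorsionCommutes (G ⧸ K) p) :
    TorsionCommutes G p := by
  have := Fact.mk hp
  have := hG.isNilpotent
  obtain ⟨n, hn⟩ := exists_powSeries_eq_bot hp hG
  have key : ∀ k j, n ≤ j + k → ∀ u ∈ powSeries G p (j + 1), ∀ g : G, u ^ p = 1 →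
      g ^ p ^ (j + 1) = 1 → Commute u g := by
    intro k
    induction k with
    | zero =>
      intro j hj u hu g _ _
      have hu' : u ∈ powSeries G p n := powSeries_antitone p (by omega) hu
      rw [hn, mem_bot] at hu'
      exact hu' ▸ Commute.one_left g
    | succ k ih =>
      intro j hj u hu g hup hg
      by_cases hu1 : u = 1
      · exact hu1 ▸ Commute.one_left g
      obtain ⟨w, hw, hwu⟩ := exists_pow_eq_of_mem_powSeries hp hodd hG h hu
      have hcmem := commutatorElement_mem_powSeries hp hodd h hw g
      have hcp : ⁅g, w⁆ ^ p = 1 := by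
        cases j with
        | zero =>
          rw [zero_add, pow_one] at hg
          have hgH : g ∈ zpowers g ⊔ powSeries G p 1 := mem_sup_left (mem_zpowers g)
          have hcH : ⁅g, w⁆ ∈ zpowers g ⊔ powSeries G p 1 := mem_sup_right hcmem
          have e : ⁅g, w⁆ = g * (w * g⁻¹ * w⁻¹) := by rw [commutatorElement_def]; group
          have hm : w * g⁻¹ * w⁻¹ = g⁻¹ * ⁅g, w⁆ := by rw [e, inv_mul_cancel_left]
          rw [e]
          refine hΩ g g hgH _ (hm ▸ mul_mem (inv_mem hgH) hcH) hg ?_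
          rw [conj_pow, inv_pow, hg, inv_one, mul_one, mul_inv_cancel]
        | succ j =>
          let K : Subgroup G :=
            { carrier := {v | v ∈ powSeries G p (j + 1) ∧ v ^ p = 1}
              one_mem' := ⟨one_mem _, one_pow p⟩
              mul_mem' := fun {a b} ha hb => ⟨mul_mem ha.1 hb.1,
                hΩ 1 a (mem_sup_right (powSeries_antitone p (Nat.le_add_left 1 j) ha.1)) b
                  (mem_sup_right (powSeries_antitone p (Nat.le_add_left 1 j) hb.1)) ha.2 hb.2⟩
              inv_mem' := fun {a} ha => ⟨inv_mem ha.1, by rw [inv_pow, ha.2, inv_one]⟩ }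
          have hKn : K.Normal := ⟨fun v hv x => ⟨(powSeries_normal p _).conj_mem v hv.1 x, by
            rw [conj_pow, hv.2, mul_one, mul_inv_cancel]⟩⟩
          have huK : u ∈ K := ⟨powSeries_antitone p (Nat.le_succ (j + 1)) hu, hup⟩
          have hK : K ≠ ⊥ := fun hK => hu1 (by rwa [hK, mem_bot] at huK)
          let f := QuotientGroup.mk' K
          have hfK : ∀ x, f x = 1 ↔ x ∈ K := fun x => QuotientGroup.eq_one_iff x
          have hcomm : Commute (f w) (f g) := by
            refine hquot K hK j (f w) ?_ (f g) ?_ ?_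
            · rw [← map_powSeries (QuotientGroup.mk'_surjective K)]
              exact mem_map_of_mem f hw
            · rw [← map_pow, hwu, hfK]
              exact huK
            · rw [← map_pow, hfK]
              refine ⟨?_, by rw [← pow_mul, ← pow_succ, hg]⟩
              have := pow_mem_powSeries_add (p := p) (i := 0) (mem_top g) (j + 1)
              rwa [zero_add] at this
          have hc : ⁅g, w⁆ ∈ K := by
            rw [← hfK, map_commutatorElement, commutatorElement_eq_one_iff_commute]
            exact hcomm.symm
          exact hc.2
      set c := ⁅g, w⁆ with hc
      have hzmem : ⁅w⁻¹, c⁻¹⁆ ∈ powSeries G p (j + 1 + 1) :=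
        commutatorElement_mem_powSeries hp hodd h (inv_mem hcmem) _
      have hc1 : c ∈ powSeries G p 1 := powSeries_antitone p (by omega) hcmem
      have hzp : ⁅w⁻¹, c⁻¹⁆ ^ p = 1 := by
        rw [commutatorElement_def, inv_inv, inv_inv]
        have hci := inv_mem hc1
        have hcc := (powSeries_normal (G := G) p 1).conj_mem _ hci w⁻¹
        rw [inv_inv] at hcc
        refine hΩ 1 _ (mem_sup_right hcc) _ (mem_sup_right hc1) ?_ hcp
        have := conj_pow (i := p) (a := w⁻¹) (b := c⁻¹)
        rw [inv_inv] at this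
        rw [this, inv_pow, hcp, inv_one, mul_one, inv_mul_cancel]
      have hzc : ∀ x : G, x ^ p ^ (j + 1 + 1) = 1 → Commute ⁅w⁻¹, c⁻¹⁆ x := fun x hx =>
        ih (j + 1) (by omega) _ hzmem x hzp hx
      have hww : w ^ p ^ (j + 1 + 1) = 1 := by
        rw [add_assoc, pow_add, mul_comm, pow_mul, show p ^ (1 + 1) = p * p from sq p,
          pow_mul, hwu, hup, one_pow]
      have hcc : c ^ p ^ (j + 1 + 1) = 1 := by
        rw [pow_succ, mul_comm, pow_mul, hcp, one_pow]
      have hmul := mul_pow_prime hp hodd (hzc c hcc) (hzc w hww) hzp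
      rw [hcp, one_mul, hc, ← conj_eq_commutatorElement_mul, ← map_pow, hwu] at hmul
      exact (mul_inv_eq_iff_eq_mul.1 hmul).symm
  exact fun j => key n j (Nat.le_add_left n j)

theorem omega_of_torsionCommutes [Finite G] {p : ℕ} (hp : p.Prime) (hodd : Odd p)
    (hG : IsPGroup p G) (h : ⁅(⊤ : Subgroup G), (⊤ : Subgroup G)⁆ ≤ sgPow ⊤ p)
    (hΩ : ∀ g : G, ∀ a ∈ zpowers g ⊔ powSeries G p 1, ∀ b ∈ zpowers g ⊔ powSeries G p 1,
      a ^ p = 1 → b ^ p = 1 → (a * b) ^ p = 1)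
    (hX : TorsionCommutes G p) {a b : G} (ha : a ^ p = 1) (hb : b ^ p = 1) :
    (a * b) ^ p = 1 := by
  have := Fact.mk hp
  have := hG.isNilpotent
  have hcmem : ⁅b⁻¹, a⁻¹⁆ ∈ powSeries G p 1 :=
    commutatorElement_mem_powSeries hp hodd h (i := 0) (mem_top _) _
  have hbH : b ∈ zpowers b ⊔ powSeries G p 1 := mem_sup_left (mem_zpowers b)
  have e : ⁅b⁻¹, a⁻¹⁆ = b⁻¹ * (a⁻¹ * b * a⁻¹⁻¹) := by rw [commutatorElement_def]; group
  have hm : a⁻¹ * b * a⁻¹⁻¹ = b * ⁅b⁻¹, a⁻¹⁆ := by rw [e, mul_inv_cancel_left]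
  have hcp : ⁅b⁻¹, a⁻¹⁆ ^ p = 1 := by
    rw [e]
    refine hΩ b _ (inv_mem hbH) _ (hm ▸ mul_mem hbH (mem_sup_right hcmem)) ?_ ?_
    · rw [inv_pow, hb, inv_one]
    · rw [conj_pow, hb, mul_one, mul_inv_cancel]
  have hc : ∀ x : G, x ^ p = 1 → Commute ⁅b⁻¹, a⁻¹⁆ x := fun x hx =>
    hX 0 _ hcmem x hcp (by rwa [zero_add, pow_one])
  rw [mul_pow_prime hp hodd (hc a ha) (hc b hb) hcp, ha, hb, one_mul]

theorem omega_and_torsionCommutes {p : ℕ} (hp : p.Prime) (hodd : Odd p) (m : ℕ) :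
    ∀ (G : Type*) [Group G] [Finite G], Nat.card G = m → IsPGroup p G →
      ⁅(⊤ : Subgroup G), (⊤ : Subgroup G)⁆ ≤ sgPow ⊤ p →
      (∀ a b : G, a ^ p = 1 → b ^ p = 1 → (a * b) ^ p = 1) ∧ TorsionCommutes G p := by
  induction m using Nat.strong_induction_on with
  | _ m ih =>
    intro G _ _ hm hG h
    by_cases hcyc : ∃ a : G, zpowers a = ⊤
    · obtain ⟨a, ha⟩ := hcyc
      have hcomm : ∀ x y : G, Commute x y := by
        intro x y
        obtain ⟨i, rfl⟩ := mem_zpowers_iff.1 (ha ▸ mem_top x : x ∈ zpowers a)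
        obtain ⟨j, rfl⟩ := mem_zpowers_iff.1 (ha ▸ mem_top y : y ∈ zpowers a)
        exact Commute.zpow_zpow_self _ _ _
      refine ⟨fun a b ha hb => ?_, fun _ u _ g _ _ => hcomm u g⟩
      rw [(hcomm a b).mul_pow, ha, hb, one_mul]
    · have hΩ : ∀ g : G, ∀ a ∈ zpowers g ⊔ powSeries G p 1, ∀ b ∈ zpowers g ⊔ powSeries G p 1,
          a ^ p = 1 → b ^ p = 1 → (a * b) ^ p = 1 := by
        intro g a ha b hb hap hbp
        have hlt : Nat.card ↥(zpowers g ⊔ powSeries G p 1) < m := by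
          rw [← hm]
          refine lt_of_le_of_ne (card_le_card_group _) fun hcard => hcyc ⟨g, ?_⟩
          exact zpowers_eq_top_of_sup_eq_top hp hodd hG h (eq_top_of_card_eq _ hcard)
        have := (ih _ hlt _ rfl (hG.to_subgroup _) (powerful_zpowers_sup hp hodd hG h g)).1
          ⟨a, ha⟩ ⟨b, hb⟩ (Subtype.ext hap) (Subtype.ext hbp)
        exact congrArg Subtype.val this
      have hX : TorsionCommutes G p := by
        refine torsionCommutes_of_quotients hp hodd hG h hΩ fun K _ hK => ?_
        have hlt : Nat.card (G ⧸ K) < m := by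
          rw [← hm, K.card_eq_card_quotient_mul_card_subgroup]
          exact lt_mul_of_one_lt_right Nat.card_pos ((one_lt_card_iff_ne_bot K).2 hK)
        exact (ih _ hlt _ rfl (hG.to_quotient K) (powerful_quotient h K)).2
      exact ⟨fun a b => omega_of_torsionCommutes hp hodd hG h hΩ hX, hX⟩

theorem commute_of_mem_powSeries [Finite G] {p : ℕ} (hp : p.Prime) (hodd : Odd p)
    (hG : IsPGroup p G) (h : ⁅(⊤ : Subgroup G), (⊤ : Subgroup G)⁆ ≤ sgPow ⊤ p)
    {N : Subgroup G} [hN : N.Normal] (hN1 : N ≤ powSeries G p 1) {i : ℕ} (hi : 1 ≤ i)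
    (hpow : ∀ m ∈ N, m ∈ powSeries G p (i + 1) → m ^ p = 1)
    {x y : G} (hxN : x ∈ N) (hxi : x ∈ powSeries G p i) (hy : y ∈ N) : Commute x y := by
  have := Fact.mk hp
  have := hG.isNilpotent
  have hX := (omega_and_torsionCommutes hp hodd _ G rfl hG h).2
  have hcN : ∀ v ∈ N, ∀ g : G, ⁅g, v⁆ ∈ N := fun v hv g =>
    commutator_le_right ⊤ N (commutator_mem_commutator (mem_top g) hv)
  obtain ⟨g, -, rfl⟩ := exists_pow_eq_of_mem_powSeries hp hodd hG h (i := 0) (hN1 hy)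
  have hdi := commutatorElement_mem_powSeries hp hodd h hxi g
  have hdN := hcN x hxN g
  have hdp := hpow _ hdN hdi
  have hei := commutatorElement_mem_powSeries hp hodd h hdi g
  have heN := hcN _ hdN g
  have hep := hpow _ heN (powSeries_antitone p (Nat.le_succ _) hei)
  have hgp : g ^ p ^ (i + 1 + 1) = 1 := by
    rw [pow_succ, mul_comm, pow_succ, ← mul_assoc, pow_mul]
    refine hpow _ ?_ ?_
    · rw [pow_mul]
      exact pow_mem hy _
    · rw [pow_mul, add_comm]
      exact pow_mem_powSeries_add (hN1 hy) i
  have heg := hX (i + 1) _ hei g hep hgp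
  have hde : Commute ⁅g, x⁆ ⁅g, ⁅g, x⁆⁆ :=
    hX 0 _ (powSeries_antitone p (by omega) hdi) _ hdp (by rwa [zero_add, pow_one])
  have hconj := conj_pow_of_class_three (conj_eq_commutatorElement_mul (g₁ := g) (g₂ := x))
    (conj_eq_commutatorElement_mul (g₁ := g) (g₂ := ⁅g, x⁆)) heg.symm hde p
  rw [pow_choose_two_eq_one hp hodd hep, hdp, one_mul, one_mul] at hconj
  exact (mul_inv_eq_iff_eq_mul.1 hconj).symm

theorem commutator_inf_powSeries_le [Finite G] {p : ℕ} (hp : p.Prime) (hodd : Odd p)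
    (hG : IsPGroup p G) (h : ⁅(⊤ : Subgroup G), (⊤ : Subgroup G)⁆ ≤ sgPow ⊤ p)
    {N : Subgroup G} [hN : N.Normal] (hN1 : N ≤ powSeries G p 1) {i : ℕ} (hi : 1 ≤ i) :
    ⁅N ⊓ powSeries G p i, N⁆ ≤ sgPow (N ⊓ powSeries G p (i + 1)) p := by
  set K := sgPow (N ⊓ powSeries G p (i + 1)) p with hK
  have hKle : K ≤ N ⊓ powSeries G p (i + 1) := sgPow_le _ p
  let f := QuotientGroup.mk' K
  have hf : Function.Surjective f := QuotientGroup.mk'_surjective K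
  have hfK : ∀ x, f x = 1 ↔ x ∈ K := fun x => QuotientGroup.eq_one_iff x
  have hn : (N.map f).Normal := Normal.map hN f hf
  rw [commutator_le]
  intro x hx y hy
  rw [← hfK, map_commutatorElement, commutatorElement_eq_one_iff_commute]
  refine commute_of_mem_powSeries hp hodd (hG.to_quotient K) (powerful_quotient h K)
    (N := N.map f) ?_ hi ?_ (mem_map_of_mem f hx.1) ?_ (mem_map_of_mem f hy)
  · rw [← map_powSeries hf]
    exact map_mono hN1
  · rw [← map_powSeries hf]
    rintro _ ⟨m, hm, rfl⟩ ⟨q, hq, hqm⟩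
    have hqK : q⁻¹ * m ∈ K := by
      rw [← hfK, map_mul, map_inv, hqm, inv_mul_cancel]
    rw [← map_pow, hfK]
    refine pow_mem_sgPow ⟨hm, ?_⟩
    rw [← mul_inv_cancel_left q m]
    exact mul_mem hq (hKle hqK).2
  · rw [← map_powSeries hf]
    exact mem_map_of_mem f hx.2

end Omega

/-- for an odd prime p, if G is a powerful p-group and N ≤ G^p is normal
in G, then N is powerfully nilpotent. -/
theorem stmt0 {G : Type*} [Group G] [Finite G] (p : ℕ) (hp : p.Prime) (hodd : Odd p)
    (hpG : IsPGroup p G)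
    (hpowerful : ⁅(⊤ : Subgroup G), (⊤ : Subgroup G)⁆ ≤ sgPow ⊤ p)
    (N : Subgroup G) (hN : N.Normal) (hNle : N ≤ sgPow ⊤ p) :
    PowerfullyNilpotentOn p N := by
  obtain ⟨n, hn⟩ := exists_powSeries_eq_bot hp hpG
  refine ⟨n, fun k => N ⊓ powSeries G p (n + 1 - k), ?_, ?_, ?_, fun _ => inf_le_left, ?_⟩
  · have hbot : powSeries G p (n + 1) = ⊥ :=
      le_bot_iff.1 (hn ▸ powSeries_antitone p (Nat.le_succ n))
    change N ⊓ powSeries G p (n + 1) = ⊥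
    rw [hbot, inf_bot_eq]
  · change N ⊓ powSeries G p (n + 1 - n) = N
    rw [Nat.add_sub_cancel_left]
    exact inf_eq_left.2 hNle
  · exact fun i => inf_le_inf_left N (powSeries_antitone p (by omega))
  · intro i hi
    obtain ⟨k, rfl⟩ := Nat.exists_eq_add_of_lt hi
    change ⁅N ⊓ powSeries G p (i + k + 1 + 1 - (i + 1)), N⁆ ≤
      sgPow (N ⊓ powSeries G p (i + k + 1 + 1 - i)) p
    rw [show i + k + 1 + 1 - (i + 1) = k + 1 by omega,
      show i + k + 1 + 1 - i = k + 1 + 1 by omega]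
    exact commutator_inf_powSeries_le hp hodd hpG hpowerful hNle (Nat.le_add_left 1 k)
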